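/- Assume y₋₁ = y₀, let (x*, y*) ∈ S* be a saddle point of the exact Lagrangian, let δ ≥ 0 and assume ‖b^δ − b*‖ ≤ δ, 0 ≤ ε_k ≤ C₀δ for every k (with C₀ ≥ 0 fixed), and ω := 1 − τ_M(L + σ_M‖A‖²) ≥ 0. Then, with C₁ = V(z₀ − z*) (z* = (x*,y*)), C₂ = C₀ + √(2σ_M V(z₀ − z*)), C₃ = √(2σ_M C₀) and C₄ = 2σ_M, the averaged iterates satisfy, for every k ≥ 1: L_{b*}(x̂_k, y*) − L_{b*}(x*, ŷ_k) ≤ C₁/k + C₂δ + C₃δ^{3/2}√k + C₄δ²k. -/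

import Mathlib

open scoped RealInnerProductSpace ENNReal NNReal
open Filter Topology

noncomputable section

/-- The `ε`-subdifferential of an extended-real-valued function `R` at `x`:
`∂_ε R (x) = {u : ∀ x', R x - R x' ≤ ⟪u, x - x'⟫ + ε}`, written without `EReal` subtraction. -/
def epsSubdiff {X : Type*} [NormedAddCommGroup X] [InnerProductSpace ℝ X]
    (R : X → EReal) (ε : ℝ) (x : X) : Set X :=
  {u | ∀ x' : X, R x + ((⟪u, x' - x⟫ - ε : ℝ) : EReal) ≤ R x'}

/-- Convexity for extended-real-valued functions. -/
def ERealConvex {X : Type*} [AddCommGroup X] [Module ℝ X] (R : X → EReal) : Prop :=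
  ∀ x y : X, ∀ t : ℝ, 0 ≤ t → t ≤ 1 →
    R (t • x + (1 - t) • y) ≤ (t : EReal) * R x + ((1 - t : ℝ) : EReal) * R y

/-- `R` is proper, convex and lower semicontinuous. -/
def ProperConvexLsc {X : Type*} [NormedAddCommGroup X] [InnerProductSpace ℝ X]
    (R : X → EReal) : Prop :=
  (∃ x, R x ≠ ⊤) ∧ (∀ x, R x ≠ ⊥) ∧ ERealConvex R ∧ LowerSemicontinuous R

/-- The Lagrangian `L_b(x,y) = R x + F x + ⟪y, A x - b⟫`. -/
def Lag {X Y : Type*} [NormedAddCommGroup X] [InnerProductSpace ℝ X]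
    [NormedAddCommGroup Y] [InnerProductSpace ℝ Y]
    (R : X → EReal) (F : X → ℝ) (A : X →L[ℝ] Y) (b : Y) (x : X) (y : Y) : EReal :=
  R x + ((F x + ⟪y, A x - b⟫ : ℝ) : EReal)

/-- Saddle points of the Lagrangian `L_b`. -/
def IsSaddle {X Y : Type*} [NormedAddCommGroup X] [InnerProductSpace ℝ X]
    [NormedAddCommGroup Y] [InnerProductSpace ℝ Y]
    (R : X → EReal) (F : X → ℝ) (A : X →L[ℝ] Y) (b : Y) (p : X × Y) : Prop :=
  ∀ x : X, ∀ y : Y, Lag R F A b p.1 y ≤ Lag R F A b x p.2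

/-- Weak convergence of a sequence in a Hilbert space. -/
def WeakTendsto {X : Type*} [NormedAddCommGroup X] [InnerProductSpace ℝ X]
    (u : ℕ → X) (l : X) : Prop :=
  ∀ w : X, Tendsto (fun k => ⟪u k, w⟫) atTop (nhds ⟪l, w⟫)

/-- `V(x,y) = ½‖x‖_T² + ½‖y‖_Σ²`, written via the inverses of the preconditioners. -/
def Vfun {X Y : Type*} [NormedAddCommGroup X] [InnerProductSpace ℝ X]
    [NormedAddCommGroup Y] [InnerProductSpace ℝ Y]
    (Tinv : X →L[ℝ] X) (Sginv : Y →L[ℝ] Y) (z : X × Y) : ℝ :=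
  1 / 2 * ⟪Tinv z.1, z.1⟫ + 1 / 2 * ⟪Sginv z.2, z.2⟫

variable {X Y : Type*}
  [NormedAddCommGroup X] [InnerProductSpace ℝ X] [CompleteSpace X]
  [NormedAddCommGroup Y] [InnerProductSpace ℝ Y] [CompleteSpace Y]

section Auxiliary

variable {E G : Type*} [NormedAddCommGroup E] [InnerProductSpace ℝ E]
  [NormedAddCommGroup G] [InnerProductSpace ℝ G]

/-- A two-sided inverse of a symmetric map is symmetric. -/
lemma inner_inverse_symm {S Sinv : E →L[ℝ] E} (hinv : ∀ v, S (Sinv v) = v)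
    (hsymm : ∀ u v : E, ⟪S u, v⟫ = ⟪u, S v⟫) (u v : E) : ⟪Sinv u, v⟫ = ⟪u, Sinv v⟫ := by
  have h := hsymm (Sinv u) (Sinv v)
  rw [hinv, hinv] at h
  exact h.symm

/-- If `0 ≤ S ≤ c`, then `‖v‖² ≤ c ⟪S⁻¹ v, v⟫`. -/
lemma sq_norm_le_mul_inner_inverse {S Sinv : E →L[ℝ] E} {m c : ℝ} (hm : 0 ≤ m) (hc : 0 < c)
    (hinv : ∀ v, S (Sinv v) = v) (hsymm : ∀ u v : E, ⟪S u, v⟫ = ⟪u, S v⟫)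
    (hS : ∀ v : E, m * ‖v‖ ^ 2 ≤ ⟪S v, v⟫ ∧ ⟪S v, v⟫ ≤ c * ‖v‖ ^ 2) (v : E) :
    ‖v‖ ^ 2 ≤ c * ⟪Sinv v, v⟫ := by
  have h1 : 0 ≤ ⟪S (v - c • Sinv v), v - c • Sinv v⟫ :=
    le_trans (by positivity) (hS _).1
  have h2 := (hS v).2
  have h3 := hsymm v (Sinv v)
  rw [hinv, real_inner_self_eq_norm_sq] at h3
  simp only [map_sub, map_smul, hinv, inner_sub_left, inner_sub_right, real_inner_smul_left,
    real_inner_smul_right, real_inner_self_eq_norm_sq, h3, real_inner_comm] at h1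
  rw [real_inner_comm] at h2 ⊢
  refine le_of_mul_le_mul_left ?_ hc
  linarith

/-- The three-point identity for a symmetric bilinear form. -/
lemma inner_sub_self_eq_of_symm {B : E →L[ℝ] E} (hB : ∀ u v : E, ⟪B u, v⟫ = ⟪u, B v⟫) (p q : E) :
    ⟪B (q - p), q⟫ = 1 / 2 * ⟪B q, q⟫ - 1 / 2 * ⟪B p, p⟫ + 1 / 2 * ⟪B (q - p), q - p⟫ := by
  have h : ⟪B p, q⟫ = ⟪B q, p⟫ := by rw [hB, real_inner_comm]
  simp only [map_sub, inner_sub_left, inner_sub_right, h]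
  ring

/-- Young's inequality for `⟪w, A u⟫`. -/
lemma abs_inner_apply_le {c q : ℝ} (hc : 0 < c) (A : E →L[ℝ] G) (w : G) (u : E)
    (hq : ‖w‖ ^ 2 ≤ c * q) : |⟪w, A u⟫| ≤ 1 / 2 * q + 1 / 2 * (c * ‖A‖ ^ 2) * ‖u‖ ^ 2 := by
  have h1 : |⟪w, A u⟫| ≤ ‖w‖ * (‖A‖ * ‖u‖) :=
    (abs_real_inner_le_norm _ _).trans
      (mul_le_mul_of_nonneg_left (A.le_opNorm u) (norm_nonneg w))
  refine h1.trans ?_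
  have h2 : 0 ≤ (‖w‖ - c * (‖A‖ * ‖u‖)) ^ 2 := sq_nonneg _
  refine le_of_mul_le_mul_left ?_ hc
  nlinarith

/-- The derivative of a function with a gradient along a line. -/
lemma HasGradientAt.hasDerivAt_comp_line [CompleteSpace E] {F : E → ℝ} {F' : E → E}
    (hF : ∀ u, HasGradientAt F (F' u) u) (u d : E) (t : ℝ) :
    HasDerivAt (fun s : ℝ => F (u + s • d)) ⟪F' (u + t • d), d⟫ t := by
  have h1 : HasDerivAt (fun s : ℝ => u + s • d) d t := by
    simpa using ((hasDerivAt_id t).smul_const d).const_add u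
  have h2 := (hF (u + t • d)).hasFDerivAt.comp_hasDerivAt t h1
  simpa using! h2

/-- The first-order characterisation of convexity. -/
lemma ConvexOn.add_inner_gradient_le [CompleteSpace E] {F : E → ℝ} {F' : E → E}
    (hconv : ConvexOn ℝ Set.univ F) (hF : ∀ u, HasGradientAt F (F' u) u) (u v : E) :
    F u + ⟪F' u, v - u⟫ ≤ F v := by
  have hd := HasGradientAt.hasDerivAt_comp_line hF u (v - u) 0
  have hc : ConvexOn ℝ Set.univ (fun s : ℝ => F (u + s • (v - u))) := by
    have h := hconv.comp_affineMap (AffineMap.lineMap u v)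
    have he : (fun s : ℝ => F (u + s • (v - u))) = F ∘ (AffineMap.lineMap u v) := by
      funext s
      simp [AffineMap.lineMap_apply, add_comm]
    rw [he]
    simpa using h
  have h := hc.le_slope_of_hasDerivAt (Set.mem_univ 0) (Set.mem_univ 1) zero_lt_one hd
  simp only [slope_def_field, zero_smul, add_zero, one_smul, add_sub_cancel, sub_zero,
    div_one] at h
  linarith

/-- The descent lemma. -/
lemma le_add_inner_gradient_add_sq [CompleteSpace E] {F : E → ℝ} {F' : E → E} {L : ℝ}
    (hF : ∀ u, HasGradientAt F (F' u) u) (hlip : ∀ u v, ‖F' u - F' v‖ ≤ L * ‖u - v‖) (u v : E) :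
    F v ≤ F u + ⟪F' u, v - u⟫ + L / 2 * ‖v - u‖ ^ 2 := by
  set d := v - u with hd
  let g : ℝ → ℝ := fun t => F (u + t • d) - (t * ⟪F' u, d⟫ + t ^ 2 * (L / 2 * ‖d‖ ^ 2))
  have hg : ∀ t, HasDerivAt g
      (⟪F' (u + t • d), d⟫ - (⟪F' u, d⟫ + 2 * t * (L / 2 * ‖d‖ ^ 2))) t := by
    intro t
    refine (HasGradientAt.hasDerivAt_comp_line hF u d t).sub (HasDerivAt.add ?_ ?_)
    · simpa using (hasDerivAt_id t).mul_const ⟪F' u, d⟫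
    · simpa using (hasDerivAt_pow 2 t).mul_const (L / 2 * ‖d‖ ^ 2)
  have hanti : AntitoneOn g (Set.Icc 0 1) := by
    refine antitoneOn_of_hasDerivWithinAt_nonpos (convex_Icc 0 1)
      (fun t _ => (hg t).continuousAt.continuousWithinAt)
      (fun t _ => (hg t).hasDerivWithinAt) ?_
    intro t ht
    rw [interior_Icc] at ht
    have h1 : ⟪F' (u + t • d) - F' u, d⟫ ≤ L * ‖t • d‖ * ‖d‖ := by
      refine (real_inner_le_norm _ _).trans (mul_le_mul_of_nonneg_right ?_ (norm_nonneg d))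
      simpa using hlip (u + t • d) u
    rw [norm_smul, Real.norm_of_nonneg ht.1.le, inner_sub_left] at h1
    nlinarith
  have h := hanti (Set.left_mem_Icc.2 zero_le_one) (Set.right_mem_Icc.2 zero_le_one) zero_le_one
  simp only [g, hd, zero_smul, add_zero, one_smul, add_sub_cancel] at h ⊢
  linarith

/-- The real part of a proper convex function is convex on its domain. -/
lemma ERealConvex.convexOn_toReal {R : E → EReal} (hconv : ERealConvex R) (hbot : ∀ x, R x ≠ ⊥) :
    ConvexOn ℝ {x | R x ≠ ⊤} (fun x => (R x).toReal) := by
  have key : ∀ x, R x ≠ ⊤ → ∀ y, R y ≠ ⊤ → ∀ a b : ℝ, 0 ≤ a → 0 ≤ b → a + b = 1 →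
      R (a • x + b • y) ≤ ((a * (R x).toReal + b * (R y).toReal : ℝ) : EReal) := by
    intro x hx y hy a b ha hb hab
    have h := hconv x y a ha (by linarith)
    rw [← EReal.coe_toReal hx (hbot x), ← EReal.coe_toReal hy (hbot y),
      show 1 - a = b by linarith] at h
    exact_mod_cast h
  refine ⟨fun x hx y hy a b ha hb hab =>
    ne_top_of_le_ne_top (EReal.coe_ne_top _) (key x hx y hy a b ha hb hab),
    fun x hx y hy a b ha hb hab => ?_⟩
  have h := EReal.toReal_le_toReal (key x hx y hy a b ha hb hab) (hbot _) (EReal.coe_ne_top _)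
  rwa [EReal.toReal_coe] at h

/-- A quantity controlled by its own running maximum is bounded, by a quadratic inequality. -/
lemma le_add_sqrt_of_sq_le_sum {a : ℕ → ℝ} {p r : ℝ} {k : ℕ} (hp : 0 ≤ p) (hr : 0 ≤ r)
    (ha : ∀ n ∈ Finset.Icc 1 k, a n ^ 2 ≤ p + r * ∑ j ∈ Finset.Icc 1 n, a j)
    (ha0 : ∀ n, 0 ≤ a n) : ∀ n ∈ Finset.Icc 1 k, a n ≤ r * k + √p := by
  intro n hn
  obtain ⟨i, hi, hmax⟩ := Finset.exists_max_image (Finset.Icc 1 k) a ⟨n, hn⟩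
  refine (hmax n hn).trans ?_
  have hsum : ∑ j ∈ Finset.Icc 1 i, a j ≤ k * a i := by
    have hik : i ≤ k := (Finset.mem_Icc.1 hi).2
    calc ∑ j ∈ Finset.Icc 1 i, a j ≤ ∑ j ∈ Finset.Icc 1 k, a j :=
          Finset.sum_le_sum_of_subset_of_nonneg (Finset.Icc_subset_Icc_right hik)
            fun j _ _ => ha0 j
      _ ≤ ∑ j ∈ Finset.Icc 1 k, a i := Finset.sum_le_sum hmax
      _ = k * a i := by simp
  have h := (ha i hi).trans (add_le_add_right (mul_le_mul_of_nonneg_left hsum hr) p)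
  have hs := Real.sq_sqrt hp
  have hs0 := Real.sqrt_nonneg p
  have hrk : 0 ≤ r * k := by positivity
  by_contra! hlt
  nlinarith [ha0 i]

/-- A saddle point is feasible. -/
lemma IsSaddle.apply_eq {R : E → EReal} {F : E → ℝ} {A : E →L[ℝ] G} {b : G} {xs : E} {ys : G}
    (h : IsSaddle R F A b (xs, ys)) (hbot : ∀ x, R x ≠ ⊥) (htop : R xs ≠ ⊤) : A xs = b := by
  have h1 := h xs (ys + (A xs - b))
  simp only [Lag] at h1
  rw [← EReal.coe_toReal htop (hbot xs)] at h1
  norm_cast at h1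
  rw [inner_add_left, real_inner_self_eq_norm_sq] at h1
  have h2 : ‖A xs - b‖ ^ 2 ≤ 0 := by linarith
  exact sub_eq_zero.1 (norm_eq_zero.1 (pow_eq_zero_iff two_ne_zero |>.1
    (le_antisymm h2 (sq_nonneg _))))

/-- The primal value at a saddle point is finite. -/
lemma IsSaddle.ne_top {R : E → EReal} {F : E → ℝ} {A : E →L[ℝ] G} {b : G} {xs : E} {ys : G}
    (h : IsSaddle R F A b (xs, ys)) (hbot : ∀ x, R x ≠ ⊥) (hprop : ∃ x, R x ≠ ⊤) : R xs ≠ ⊤ := by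
  obtain ⟨x, hx⟩ := hprop
  intro htop
  have h1 := h x 0
  simp only [Lag] at h1
  rw [htop, EReal.top_add_coe, ← EReal.coe_toReal hx (hbot x), ← EReal.coe_add, top_le_iff] at h1
  exact EReal.coe_ne_top _ h1

/-- One step of the primal–dual iteration decreases the energy, up to the errors. -/
lemma primal_dual_step_le [CompleteSpace E] [CompleteSpace G] {A : E →L[ℝ] G}
    {Tinv : E →L[ℝ] E} {Sg Sginv : G →L[ℝ] G} {L τ σ : ℝ} (hσ : 0 < σ) (hL : 0 ≤ L)
    (hω : 0 ≤ 1 - τ * (L + σ * ‖A‖ ^ 2))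
    (hTsymm : ∀ u v : E, ⟪Tinv u, v⟫ = ⟪u, Tinv v⟫)
    (hSsymm : ∀ u v : G, ⟪Sginv u, v⟫ = ⟪u, Sginv v⟫)
    (hSinv : ∀ v, Sginv (Sg v) = v)
    (hT : ∀ u : E, ‖u‖ ^ 2 ≤ τ * ⟪Tinv u, u⟫) (hT0 : ∀ u : E, 0 ≤ ⟪Tinv u, u⟫)
    (hS : ∀ v : G, ‖v‖ ^ 2 ≤ σ * ⟪Sginv v, v⟫)
    {x x' xs g : E} {y y' d ys b bs : G} {r' rs f' fs e : ℝ}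
    (hR : r' + (⟪-(Tinv (x' - x)) - g - ContinuousLinearMap.adjoint A (y + d), xs - x'⟫ - e) ≤ rs)
    (hF : f' ≤ fs + ⟪g, x' - xs⟫ + L / 2 * ‖x' - x‖ ^ 2)
    (hy : y' = y + Sg (A x' - b)) (hxs : A xs = bs) :
    (r' + f' + ⟪ys, A x' - bs⟫ - (rs + fs)) + (Vfun Tinv Sginv (x' - xs, y' - ys)
        + 1 / 2 * ⟪Sginv (y' - y), y' - y⟫ - ⟪y' - y, A (x' - xs)⟫)
      ≤ (Vfun Tinv Sginv (x - xs, y - ys) + 1 / 2 * ⟪Sginv d, d⟫ - ⟪d, A (x - xs)⟫)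
        + e + ⟪ys - y', b - bs⟫ := by
  have hX := inner_sub_self_eq_of_symm hTsymm (x - xs) (x' - xs)
  have hY := inner_sub_self_eq_of_symm hSsymm (y - ys) (y' - ys)
  simp only [sub_sub_sub_cancel_right] at hX hY
  have hdy : Sginv (y' - y) = A x' - b := by rw [hy, add_sub_cancel_left, hSinv]
  have hyoung := neg_le_of_abs_le (abs_inner_apply_le hσ A d (x' - x) (hS d))
  have hquad : (L + σ * ‖A‖ ^ 2) * ‖x' - x‖ ^ 2 ≤ ⟪Tinv (x' - x), x' - x⟫ := by
    have hpos : 0 ≤ L + σ * ‖A‖ ^ 2 := by positivity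
    have h1 := mul_le_mul_of_nonneg_left (hT (x' - x)) hpos
    have h2 := mul_nonneg hω (hT0 (x' - x))
    linarith
  have hR' : ⟪-(Tinv (x' - x)) - g - ContinuousLinearMap.adjoint A (y + d), xs - x'⟫
      = ⟪Tinv (x' - x), x' - xs⟫ + ⟪g, x' - xs⟫ + ⟪y + d, A (x' - xs)⟫ := by
    rw [← neg_sub x' xs, inner_neg_right, inner_sub_left, inner_sub_left, inner_neg_left,
      ContinuousLinearMap.adjoint_inner_left]
    ring
  have hAx : A (x' - xs) = A x' - bs := by rw [map_sub, hxs]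
  have hcoup : ⟪ys - y', b - bs⟫ - ⟪Sginv (y' - y), y' - ys⟫
      = ⟪ys, A x' - bs⟫ - ⟪y', A (x' - xs)⟫ := by
    rw [hdy, hAx, real_inner_comm, ← neg_sub y' ys, inner_neg_right, ← inner_neg_left,
      ← inner_sub_left, real_inner_comm, ← inner_sub_left, ← neg_sub ys y', inner_neg_left,
      ← inner_neg_right]
    congr 1
    abel
  have hsplit : ⟪d, A (x' - xs)⟫ = ⟪d, A (x - xs)⟫ + ⟪d, A (x' - x)⟫ := by
    rw [← inner_add_right, ← map_add]
    congr 2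
    abel
  rw [hR', inner_add_left] at hR
  rw [inner_sub_left y' y]
  simp only [Vfun]
  linarith

end Auxiliary

/-- Stability bound on the Lagrangian gap of the averaged iterates, with the
explicit constants `C₁ = V(z₀ - z*)`, `C₂ = C₀ + √(2 σ_M V(z₀ - z*))`, `C₃ = √(2 σ_M C₀)`,
`C₄ = 2 σ_M`. -/
theorem statement_2
    (A : X →L[ℝ] Y) (bstar : Y)
    (R : X → EReal) (hR : ProperConvexLsc R)
    (F : X → ℝ) (F' : X → X) (L : ℝ) (hL : 0 ≤ L)
    (hFconv : ConvexOn ℝ Set.univ F)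
    (hFgrad : ∀ u : X, HasGradientAt F (F' u) u)
    (hFlip : ∀ u v : X, ‖F' u - F' v‖ ≤ L * ‖u - v‖)
    (T Tinv : X →L[ℝ] X) (Sg Sginv : Y →L[ℝ] Y)
    (hTinv : ∀ u, Tinv (T u) = u) (hTinv' : ∀ u, T (Tinv u) = u)
    (hSginv : ∀ v, Sginv (Sg v) = v) (hSginv' : ∀ v, Sg (Sginv v) = v)
    (hTsa : ∀ u v : X, ⟪T u, v⟫ = ⟪u, T v⟫)
    (hSgsa : ∀ u v : Y, ⟪Sg u, v⟫ = ⟪u, Sg v⟫)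
    (τm τM σm σM : ℝ) (hτm : 0 < τm) (hττ : τm ≤ τM) (hσm : 0 < σm) (hσσ : σm ≤ σM)
    (hTb : ∀ u : X, τm * ‖u‖ ^ 2 ≤ ⟪T u, u⟫ ∧ ⟪T u, u⟫ ≤ τM * ‖u‖ ^ 2)
    (hSgb : ∀ v : Y, σm * ‖v‖ ^ 2 ≤ ⟪Sg v, v⟫ ∧ ⟪Sg v, v⟫ ≤ σM * ‖v‖ ^ 2)
    (hω : 0 ≤ 1 - τM * (L + σM * ‖A‖ ^ 2))
    (xstar : X) (ystar : Y) (hsaddle : IsSaddle R F A bstar (xstar, ystar))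
    (δ : ℝ) (hδ : 0 ≤ δ) (bδ : Y) (hnoise : ‖bδ - bstar‖ ≤ δ)
    (C₀ : ℝ) (hC₀ : 0 ≤ C₀)
    (ε : ℕ → ℝ) (hε : ∀ k, 0 ≤ ε k ∧ ε k ≤ C₀ * δ)
    (x : ℕ → X) (y : ℕ → Y) (ym1 : Y) (hinit : ym1 = y 0)
    (hstep : ∀ k : ℕ,
      -(Tinv (x (k + 1) - x k)) - F' (x k)
          - ContinuousLinearMap.adjoint A ((2 : ℝ) • y k - (if k = 0 then ym1 else y (k - 1)))
        ∈ epsSubdiff R (ε (k + 1)) (x (k + 1)))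
    (hdual : ∀ k : ℕ, y (k + 1) = y k + Sg (A (x (k + 1)) - bδ)) :
    ∀ k : ℕ, 1 ≤ k →
      Lag R F A bstar ((k : ℝ)⁻¹ • ∑ j ∈ Finset.Icc 1 k, x j) ystar
          - Lag R F A bstar xstar ((k : ℝ)⁻¹ • ∑ j ∈ Finset.Icc 1 k, y j)
        ≤ ((Vfun Tinv Sginv (x 0 - xstar, y 0 - ystar) / k
            + (C₀ + Real.sqrt (2 * σM * Vfun Tinv Sginv (x 0 - xstar, y 0 - ystar))) * δ
            + Real.sqrt (2 * σM * C₀) * δ ^ ((3 : ℝ) / 2) * Real.sqrt k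
            + 2 * σM * δ ^ 2 * k : ℝ) : EReal) := by
  have hbot := hR.2.1
  have hτM : 0 < τM := hτm.trans_le hττ
  have hσM : 0 < σM := hσm.trans_le hσσ
  have hTq := sq_norm_le_mul_inner_inverse hτm.le hτM hTinv' hTsa hTb
  have hSq := sq_norm_le_mul_inner_inverse hσm.le hσM hSginv' hSgsa hSgb
  have hT0 : ∀ u : X, 0 ≤ ⟪Tinv u, u⟫ := fun u =>
    nonneg_of_mul_nonneg_right ((sq_nonneg _).trans (hTq u)) hτM
  have hS0 : ∀ v : Y, 0 ≤ ⟪Sginv v, v⟫ := fun v =>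
    nonneg_of_mul_nonneg_right ((sq_nonneg _).trans (hSq v)) hσM
  have hstar : R xstar ≠ ⊤ := hsaddle.ne_top hbot hR.1
  have hfeas : A xstar = bstar := hsaddle.apply_eq hbot hstar
  have hsub : ∀ k, R (x (k + 1)) + ((⟪-(Tinv (x (k + 1) - x k)) - F' (x k)
      - ContinuousLinearMap.adjoint A (y k + (y k - y (k - 1))), xstar - x (k + 1)⟫
      - ε (k + 1) : ℝ) : EReal) ≤ R xstar := by
    intro k
    have h := hstep k xstar
    have he : (2 : ℝ) • y k - (if k = 0 then ym1 else y (k - 1)) = y k + (y k - y (k - 1)) := by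
      rcases k with _ | k
      · simp [hinit, two_smul]
      · simp [two_smul, add_sub_assoc]
    rwa [he] at h
  have hdom : ∀ k, R (x (k + 1)) ≠ ⊤ := by
    intro k htop
    have h := hsub k
    rw [htop, EReal.top_add_coe, top_le_iff] at h
    exact hstar h
  let φ : X → ℝ := fun u => (R u).toReal + F u + ⟪ystar, A u - bstar⟫
  let gap : ℕ → ℝ := fun n => φ (x n) - ((R xstar).toReal + F xstar)
  let V : ℕ → ℝ := fun n => Vfun Tinv Sginv (x n - xstar, y n - ystar)
  let a : ℕ → ℝ := fun n => ‖y n - ystar‖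
  let energy : ℕ → ℝ := fun n => V n + 1 / 2 * ⟪Sginv (y n - y (n - 1)), y n - y (n - 1)⟫
    - ⟪y n - y (n - 1), A (x n - xstar)⟫
  have hdescent : ∀ n, gap (n + 1) + energy (n + 1) ≤ energy n + C₀ * δ + δ * a (n + 1) := by
    intro n
    have hRn := hsub n
    rw [← EReal.coe_toReal (hdom n) (hbot _), ← EReal.coe_toReal hstar (hbot _)] at hRn
    norm_cast at hRn
    have hFn : F (x (n + 1)) ≤ F xstar + ⟪F' (x n), x (n + 1) - xstar⟫
        + L / 2 * ‖x (n + 1) - x n‖ ^ 2 := by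
      have h1 := le_add_inner_gradient_add_sq hFgrad hFlip (x n) (x (n + 1))
      have h2 := hFconv.add_inner_gradient_le hFgrad (x n) xstar
      have h3 : ⟪F' (x n), x (n + 1) - x n⟫
          = ⟪F' (x n), x (n + 1) - xstar⟫ + ⟪F' (x n), xstar - x n⟫ := by
        rw [← inner_add_right, sub_add_sub_cancel]
      linarith
    have h := primal_dual_step_le (ys := ystar) hσM hL hω (inner_inverse_symm hTinv' hTsa)
      (inner_inverse_symm hSginv' hSgsa) hSginv hTq hT0 hSq hRn hFn (hdual n) hfeas
    have hnoise' : ⟪ystar - y (n + 1), bδ - bstar⟫ ≤ δ * a (n + 1) := by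
      refine (real_inner_le_norm _ _).trans ?_
      rw [norm_sub_rev, mul_comm]
      exact mul_le_mul_of_nonneg_right hnoise (norm_nonneg _)
    have he := (hε (n + 1)).2
    simp only [gap, energy, V, φ, Nat.add_sub_cancel]
    linarith
  have htele : ∀ n : ℕ, ∑ j ∈ Finset.Icc 1 n, gap j + energy n
      ≤ V 0 + n * (C₀ * δ) + δ * ∑ j ∈ Finset.Icc 1 n, a j := by
    intro n
    induction n with
    | zero => simp [energy]
    | succ n ih =>
      rw [Finset.sum_Icc_succ_top (by omega), Finset.sum_Icc_succ_top (by omega)]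
      have h := hdescent n
      push_cast
      linarith
  have henergy : ∀ n, 1 / 2 * ⟪Sginv (y n - ystar), y n - ystar⟫ ≤ energy n := by
    intro n
    have hyoung := le_of_abs_le (abs_inner_apply_le hσM A (y n - y (n - 1)) (x n - xstar) (hSq _))
    have hquad : σM * ‖A‖ ^ 2 * ‖x n - xstar‖ ^ 2 ≤ ⟪Tinv (x n - xstar), x n - xstar⟫ := by
      have h1 := mul_le_mul_of_nonneg_left (hTq (x n - xstar))
        (by positivity : 0 ≤ σM * ‖A‖ ^ 2)
      have h2 := mul_nonneg hω (hT0 (x n - xstar))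
      have h3 := mul_nonneg (mul_nonneg hτM.le hL) (hT0 (x n - xstar))
      linarith
    simp only [energy, V, Vfun]
    linarith
  have hgap : ∀ n, 0 ≤ gap (n + 1) := by
    intro n
    have h := hsaddle (x (n + 1)) 0
    simp only [Lag] at h
    rw [← EReal.coe_toReal (hdom n) (hbot _), ← EReal.coe_toReal hstar (hbot _)] at h
    norm_cast at h
    rw [inner_zero_left] at h
    simp only [gap, φ]
    linarith
  have hgapsum : ∀ n, 0 ≤ ∑ j ∈ Finset.Icc 1 n, gap j := fun n =>
    Finset.sum_nonneg fun j hj => by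
      obtain ⟨i, rfl⟩ := Nat.exists_eq_add_of_le' (Finset.mem_Icc.1 hj).1
      exact hgap i
  have hV0 : 0 ≤ V 0 := by
    have h1 := hT0 (x 0 - xstar)
    have h2 := hS0 (y 0 - ystar)
    simp only [V, Vfun]
    linarith
  intro k hk
  have hk0 : (0 : ℝ) < k := by exact_mod_cast hk
  have hdist : ∀ n ∈ Finset.Icc 1 k,
      a n ≤ 2 * σM * δ * k + √(2 * σM * (V 0 + k * (C₀ * δ))) := by
    refine le_add_sqrt_of_sq_le_sum (by positivity) (by positivity) (fun n hn => ?_)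
      fun n => norm_nonneg _
    have hnk : (n : ℝ) * (C₀ * δ) ≤ k * (C₀ * δ) :=
      mul_le_mul_of_nonneg_right (by exact_mod_cast (Finset.mem_Icc.1 hn).2) (by positivity)
    have h1 := htele n
    have h2 := henergy n
    have h3 := hgapsum n
    have h4 : ⟪Sginv (y n - ystar), y n - ystar⟫
        ≤ 2 * (V 0 + k * (C₀ * δ) + δ * ∑ j ∈ Finset.Icc 1 n, a j) := by linarith
    have h5 := mul_le_mul_of_nonneg_left h4 hσM.le
    have h6 : a n ^ 2 ≤ _ := hSq (y n - ystar)
    linarith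
  set M := 2 * σM * δ * k + √(2 * σM * (V 0 + k * (C₀ * δ))) with hM
  have hsum : ∑ j ∈ Finset.Icc 1 k, gap j ≤ V 0 + k * (C₀ * δ) + δ * (k * M) := by
    have h1 := htele k
    have h2 : 0 ≤ energy k := le_trans (mul_nonneg (by norm_num) (hS0 _)) (henergy k)
    have h3 : ∑ j ∈ Finset.Icc 1 k, a j ≤ k * M := by
      simpa using Finset.sum_le_sum hdist
    have h4 := mul_le_mul_of_nonneg_left h3 hδ
    linarith
  have hMle : M ≤ 2 * σM * δ * k + √(2 * σM * V 0) + √(2 * σM * C₀) * √δ * √k := by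
    have h1 : √(2 * σM * (V 0 + k * (C₀ * δ))) ≤ √(2 * σM * V 0) + √(2 * σM * C₀ * δ * k) := by
      rw [show 2 * σM * (V 0 + k * (C₀ * δ)) = 2 * σM * V 0 + 2 * σM * C₀ * δ * k by ring]
      have h2 : 0 ≤ 2 * σM * V 0 := by positivity
      have h3 : 0 ≤ 2 * σM * C₀ * δ * k := by positivity
      refine Real.sqrt_le_iff.2 ⟨by positivity, ?_⟩
      rw [add_sq, Real.sq_sqrt h2, Real.sq_sqrt h3]
      linarith [show 0 ≤ 2 * √(2 * σM * V 0) * √(2 * σM * C₀ * δ * k) by positivity]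
    rw [Real.sqrt_mul (by positivity) (k : ℝ), Real.sqrt_mul (by positivity) δ] at h1
    linarith
  have hpow : δ ^ ((3 : ℝ) / 2) = δ * √δ := by
    rw [show (3 : ℝ) / 2 = 1 + 1 / 2 by norm_num, Real.rpow_add_of_nonneg hδ (by norm_num)
      (by norm_num), Real.rpow_one, Real.sqrt_eq_rpow]
  have hφ : ConvexOn ℝ {u | R u ≠ ⊤} φ := by
    have hr := hR.2.2.1.convexOn_toReal hbot
    refine (hr.add (hFconv.subset (Set.subset_univ _) hr.1)).add
      ⟨hr.1, fun u _ v _ s t _ _ hst => le_of_eq ?_⟩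
    have hb : bstar = s • bstar + t • bstar := by rw [← add_smul, hst, one_smul]
    simp only [smul_eq_mul]
    rw [← real_inner_smul_right, ← real_inner_smul_right, ← inner_add_right]
    congr 1
    nth_rewrite 1 [hb]
    simp only [map_add, map_smul, smul_sub]
    abel
  have hmem : ∀ j ∈ Finset.Icc 1 k, x j ∈ {u | R u ≠ ⊤} := by
    intro j hj
    obtain ⟨i, rfl⟩ := Nat.exists_eq_add_of_le' (Finset.mem_Icc.1 hj).1
    exact hdom i
  have hw0 : ∀ j ∈ Finset.Icc 1 k, (0 : ℝ) ≤ (k : ℝ)⁻¹ := fun _ _ => by positivity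
  have hw1 : ∑ j ∈ Finset.Icc 1 k, (k : ℝ)⁻¹ = 1 := by simp [hk0.ne']
  have havg := hφ.map_sum_le hw0 hw1 hmem
  have havgdom := hφ.1.sum_mem hw0 hw1 hmem
  rw [← Finset.smul_sum] at havg havgdom
  rw [← Finset.smul_sum, smul_eq_mul] at havg
  have hgapavg : φ ((k : ℝ)⁻¹ • ∑ j ∈ Finset.Icc 1 k, x j) - ((R xstar).toReal + F xstar)
      ≤ (k : ℝ)⁻¹ * ∑ j ∈ Finset.Icc 1 k, gap j := by
    simp only [gap, Finset.sum_sub_distrib, mul_sub]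
    simp only [Finset.sum_const, Nat.card_Icc, Nat.add_sub_cancel, nsmul_eq_mul,
      inv_mul_cancel_left₀ hk0.ne']
    linarith
  simp only [Lag, hfeas, sub_self, inner_zero_right, add_zero]
  rw [← EReal.coe_toReal havgdom (hbot _), ← EReal.coe_toReal hstar (hbot _)]
  norm_cast
  have hfinal : (k : ℝ)⁻¹ * ∑ j ∈ Finset.Icc 1 k, gap j ≤ V 0 / k + C₀ * δ + δ * M := by
    refine (mul_le_mul_of_nonneg_left hsum (inv_nonneg.2 hk0.le)).trans (le_of_eq ?_)
    field_simp
  have hδM := mul_le_mul_of_nonneg_left hMle hδ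
  rw [hpow]
  simp only [φ, V] at hgapavg hfinal hδM
  linarith
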